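/- There exists a constant C > 0 such that for every positive integer n, every Green function Gₙ of the ball B(n), and every Green function Gₙ₊₁ of the ball B(n+1), one has |Gₙ₊₁(v) − Gₙ(v)| ≤ C/n for every v ∈ ℤ². -/

import Mathlib

noncomputable section

/-- Discrete Laplacian on the nearest-neighbor graph of `ℤ²`. -/
def lapZ (f : ℤ × ℤ → ℝ) (v : ℤ × ℤ) : ℝ :=
  4 * f v - (f (v.1 + 1, v.2) + f (v.1 - 1, v.2) + f (v.1, v.2 + 1) + f (v.1, v.2 - 1))

/-- Euclidean norm of a point of `ℤ²`. -/
def znorm (v : ℤ × ℤ) : ℝ := Real.sqrt ((v.1 : ℝ) ^ 2 + (v.2 : ℝ) ^ 2)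

/-- `G` is a Green function of the ball `B(n) = {v : |v| ≤ n}`. -/
def IsGreen (n : ℕ) (G : ℤ × ℤ → ℝ) : Prop :=
  (∀ v : ℤ × ℤ, (n : ℝ) < znorm v → G v = 0) ∧
  lapZ G (0, 0) = 1 ∧
  (∀ v : ℤ × ℤ, znorm v ≤ (n : ℝ) → v ≠ (0, 0) → lapZ G v = 0)


lemma znorm_nonneg (v : ℤ × ℤ) : 0 ≤ znorm v := Real.sqrt_nonneg _

lemma znorm_sq (v : ℤ × ℤ) : znorm v ^ 2 = (v.1 : ℝ) ^ 2 + (v.2 : ℝ) ^ 2 :=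
  Real.sq_sqrt (by positivity)

lemma abs_fst_le_znorm (v : ℤ × ℤ) : |(v.1 : ℝ)| ≤ znorm v :=
  Real.abs_le_sqrt (by nlinarith [sq_nonneg (v.2 : ℝ)])

lemma abs_snd_le_znorm (v : ℤ × ℤ) : |(v.2 : ℝ)| ≤ znorm v :=
  Real.abs_le_sqrt (by nlinarith [sq_nonneg (v.1 : ℝ)])

/-- The norm grows by at most one along an edge. -/
lemma znorm_neighbor_le (v : ℤ × ℤ) :
    znorm (v.1 + 1, v.2) ≤ znorm v + 1 ∧ znorm (v.1 - 1, v.2) ≤ znorm v + 1 ∧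
      znorm (v.1, v.2 + 1) ≤ znorm v + 1 ∧ znorm (v.1, v.2 - 1) ≤ znorm v + 1 := by
  have h0 := znorm_nonneg v
  have h1 := abs_le.mp (abs_fst_le_znorm v)
  have h2 := abs_le.mp (abs_snd_le_znorm v)
  have h3 := znorm_sq v
  refine ⟨?_, ?_, ?_, ?_⟩ <;>
  · refine Real.sqrt_le_iff.mpr ⟨by linarith, ?_⟩
    push_cast
    nlinarith

lemma finite_ball (m : ℝ) : {v : ℤ × ℤ | znorm v ≤ m}.Finite := by
  refine ((Set.finite_Icc (-⌈m⌉) ⌈m⌉).prod (Set.finite_Icc (-⌈m⌉) ⌈m⌉)).subset ?_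
  intro v hv
  have hm : m ≤ (⌈m⌉ : ℝ) := Int.le_ceil m
  have h1 := abs_le.mp ((abs_fst_le_znorm v).trans (le_trans hv hm))
  have h2 := abs_le.mp ((abs_snd_le_znorm v).trans (le_trans hv hm))
  exact ⟨⟨by exact_mod_cast h1.1, by exact_mod_cast h1.2⟩,
    ⟨by exact_mod_cast h2.1, by exact_mod_cast h2.2⟩⟩

/-- Maximum principle for subharmonic functions on a ball. -/
lemma le_of_lapZ_nonpos {m M : ℝ} {f : ℤ × ℤ → ℝ}
    (hf : ∀ v, znorm v ≤ m → lapZ f v ≤ 0)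
    (hM : ∀ v, m < znorm v → znorm v ≤ m + 1 → f v ≤ M) {v : ℤ × ℤ} (hv : znorm v ≤ m) :
    f v ≤ M := by
  by_contra! hlt
  obtain ⟨u, hu, hmax⟩ := Set.exists_max_image _ f (finite_ball m) ⟨v, hv⟩
  have hMu : M < f u := hlt.trans_le (hmax v hv)
  obtain ⟨w, ⟨hw, hwu⟩, hwmax⟩ := Set.exists_max_image {w | znorm w ≤ m ∧ f w = f u} Prod.fst
    ((finite_ball m).subset fun _ h => h.1) ⟨u, hu, rfl⟩
  have hle : ∀ z, znorm z ≤ znorm w + 1 → f z ≤ f u := by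
    intro z hz
    rcases le_or_gt (znorm z) m with h | h
    · exact hmax z h
    · exact (hM z h (hz.trans (by simpa using hw))).trans hMu.le
  obtain ⟨n1, n2, n3, n4⟩ := znorm_neighbor_le w
  have hlap := hf w hw
  unfold lapZ at hlap
  have heq : f (w.1 + 1, w.2) = f u :=
    le_antisymm (hle _ n1) (by linarith [hle _ n2, hle _ n3, hle _ n4])
  have hball : znorm (w.1 + 1, w.2) ≤ m := by
    by_contra! h
    linarith [hM _ h (n1.trans (by simpa using hw))]
  have := hwmax _ ⟨hball, heq⟩
  simp at this

/-- The logarithmic barrier `log (|v|² + 1)`. -/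
def logBarrier (v : ℤ × ℤ) : ℝ := Real.log (znorm v ^ 2 + 1)

lemma lapZ_logBarrier_nonpos (v : ℤ × ℤ) : lapZ logBarrier v ≤ 0 := by
  obtain ⟨a, b⟩ := v
  simp only [lapZ, logBarrier, znorm_sq]
  push_cast
  generalize (a : ℝ) = x, (b : ℝ) = y
  rw [← Real.log_mul (by positivity) (by positivity), ← Real.log_mul (by positivity) (by positivity),
    ← Real.log_mul (by positivity) (by positivity)]
  have h4 : 4 * Real.log (x ^ 2 + y ^ 2 + 1) = Real.log ((x ^ 2 + y ^ 2 + 1) ^ 4) := by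
    rw [Real.log_pow]; norm_num
  rw [h4, sub_nonpos]
  refine Real.log_le_log (by positivity) (sub_nonneg.mp ?_)
  have hdiff : ((x + 1) ^ 2 + y ^ 2 + 1) * ((x - 1) ^ 2 + y ^ 2 + 1) *
      (x ^ 2 + (y + 1) ^ 2 + 1) * (x ^ 2 + (y - 1) ^ 2 + 1) - (x ^ 2 + y ^ 2 + 1) ^ 4 =
      2 * (x ^ 2 + y ^ 2) ^ 2 + 12 * (x ^ 2 + y ^ 2) + 15 + 16 * (x * y) ^ 2 := by ring
  rw [hdiff]
  positivity

lemma lapZ_logBarrier_zero : lapZ logBarrier (0, 0) ≤ -1 := by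
  simp only [lapZ, logBarrier, znorm_sq]
  norm_num
  linarith [Real.log_two_gt_d9]

lemma lapZ_sub (f g : ℤ × ℤ → ℝ) (v : ℤ × ℤ) :
    lapZ (fun z => f z - g z) v = lapZ f v - lapZ g v := by
  simp only [lapZ]; ring

namespace IsGreen

variable {m n : ℕ} {G H : ℤ × ℤ → ℝ}

lemma lapZ_nonneg (hG : IsGreen m G) {v : ℤ × ℤ} (hv : znorm v ≤ m) : 0 ≤ lapZ G v := by
  by_cases h : v = (0, 0)
  · rw [h, hG.2.1]; norm_num
  · exact (hG.2.2 v hv h).ge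

lemma nonneg (hG : IsGreen m G) (v : ℤ × ℤ) : 0 ≤ G v := by
  rcases le_or_gt (znorm v) m with hv | hv
  · refine neg_nonpos.mp (le_of_lapZ_nonpos (f := fun z => -G z) (fun z hz => ?_)
      (fun z hz _ => by simp [hG.1 z hz]) hv)
    have := hG.lapZ_nonneg hz
    simp only [lapZ] at this ⊢
    linarith
  · exact (hG.1 v hv).ge

lemma le_log_sub_logBarrier (hG : IsGreen m G) {v : ℤ × ℤ} (hv : znorm v ≤ m) :
    G v ≤ Real.log (((m : ℝ) + 1) ^ 2 + 1) - logBarrier v := by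
  suffices h : G v + logBarrier v ≤ Real.log (((m : ℝ) + 1) ^ 2 + 1) by linarith
  refine le_of_lapZ_nonpos (f := fun z => G z + logBarrier z) (fun z hz => ?_)
    (fun z hz hz' => ?_) hv
  · have hadd : lapZ (fun z => G z + logBarrier z) z = lapZ G z + lapZ logBarrier z := by
      simp only [lapZ]; ring
    rw [hadd]
    by_cases h : z = (0, 0)
    · rw [h, hG.2.1]; linarith [lapZ_logBarrier_zero]
    · rw [hG.2.2 z hz h]; linarith [lapZ_logBarrier_nonpos z]
  · simp only [hG.1 z hz, zero_add, logBarrier]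
    have := znorm_nonneg z
    gcongr

/-- Near the boundary of the ball a Green function is of the order of the inverse radius. -/
lemma le_div_of_lt_znorm (hn : 0 < n) (hG : IsGreen (n + 1) G) {v : ℤ × ℤ}
    (hv : (n : ℝ) < znorm v) : G v ≤ 8 / n := by
  have hn1 : (1 : ℝ) ≤ n := by exact_mod_cast hn
  rcases le_or_gt (znorm v) ((n + 1 : ℕ) : ℝ) with hle | hlt
  · have h := hG.le_log_sub_logBarrier hle
    have hlog : Real.log ((n : ℝ) ^ 2 + 1) ≤ logBarrier v := by
      unfold logBarrier
      gcongr
    push_cast at h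
    have hquot : Real.log (((n : ℝ) + 1 + 1) ^ 2 + 1) - Real.log ((n : ℝ) ^ 2 + 1) ≤
        (((n : ℝ) + 1 + 1) ^ 2 + 1) / ((n : ℝ) ^ 2 + 1) - 1 := by
      rw [← Real.log_div (by positivity) (by positivity)]
      exact Real.log_le_sub_one_of_pos (by positivity)
    have hbound : (((n : ℝ) + 1 + 1) ^ 2 + 1) / ((n : ℝ) ^ 2 + 1) - 1 ≤ 8 / n := by
      rw [div_sub_one (by positivity), div_le_div_iff₀ (by positivity) (by positivity)]
      nlinarith
    linarith
  · rw [hG.1 v hlt]; positivity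

/-- The difference of Green functions is harmonic on the smaller ball. -/
lemma lapZ_sub_eq_zero (hmn : m ≤ n) (hG : IsGreen m G) (hH : IsGreen n H) {v : ℤ × ℤ}
    (hv : znorm v ≤ m) : lapZ H v - lapZ G v = 0 := by
  by_cases h : v = (0, 0)
  · rw [h, hG.2.1, hH.2.1, sub_self]
  · rw [hG.2.2 v hv h, hH.2.2 v (hv.trans (by exact_mod_cast hmn)) h, sub_self]

end IsGreen

/-- Green functions of the balls `B(n)` and `B(n+1)` differ by at most `C/n`. -/
theorem green_consecutive_difference_bound :
    ∃ C : ℝ, 0 < C ∧ ∀ n : ℕ, 0 < n → ∀ Gn Gn1 : ℤ × ℤ → ℝ,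
      IsGreen n Gn → IsGreen (n + 1) Gn1 →
      ∀ v : ℤ × ℤ, |Gn1 v - Gn v| ≤ C / n := by
  refine ⟨8, by norm_num, fun n hn Gn Gn1 hG hH v => ?_⟩
  have hout : ∀ z, (n : ℝ) < znorm z → |Gn1 z - Gn z| ≤ 8 / n := fun z hz => by
    rw [hG.1 z hz, sub_zero, abs_of_nonneg (hH.nonneg z)]
    exact hH.le_div_of_lt_znorm hn hz
  rcases le_or_gt (znorm v) n with hv | hv
  · have hlap : ∀ z, znorm z ≤ n → lapZ Gn1 z - lapZ Gn z = 0 := fun z hz =>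
      hG.lapZ_sub_eq_zero n.le_succ hH hz
    refine abs_sub_le_iff.mpr ⟨?_, ?_⟩
    · exact le_of_lapZ_nonpos (f := fun z => Gn1 z - Gn z)
        (fun z hz => by rw [lapZ_sub, hlap z hz])
        (fun z hz _ => (abs_sub_le_iff.mp (hout z hz)).1) hv
    · exact le_of_lapZ_nonpos (f := fun z => Gn z - Gn1 z)
        (fun z hz => by rw [lapZ_sub]; linarith [hlap z hz])
        (fun z hz _ => (abs_sub_le_iff.mp (hout z hz)).2) hv
  · exact hout v hv
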